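/- Let Γ be a connected core multigraph equipped with external momenta, and γ ⊆ Γ a core subgraph. Then φ(Γ) = φ(Γ//γ)·ψ(γ) + φ_{Γ,γ}, where the remainder φ_{Γ,γ} := φ(Γ) − φ(Γ//γ)·ψ(γ) has the property that every one of its monomials has total degree in the variables {A_e : e ∈ γ} strictly greater than h1(γ), the degree of ψ(γ). -/

import Mathlib

open scoped Classical

/-- A multigraph: finite sets of vertices and edges, where each edge is
assigned an unordered pair of (possibly equal) endpoints. -/
structure Multigraph where
  V : Type
  E : Type
  finV : Finite V
  finE : Finite E
  ends : E → Sym2 V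

attribute [instance] Multigraph.finV Multigraph.finE

namespace Multigraph

variable (G : Multigraph)

/-- `v` and `w` are joined by some edge belonging to `μ`. -/
def Step (μ : Set G.E) (v w : G.V) : Prop :=
  ∃ e ∈ μ, G.ends e = s(v, w)

/-- Connectivity with respect to the edge set `μ`, as a setoid on all vertices. -/
def connSetoid (μ : Set G.E) : Setoid G.V :=
  Relation.EqvGen.setoid (G.Step μ)

/-- The number of connected components of the spanning subgraph `(V(G), μ)`. -/
noncomputable def h0 (μ : Set G.E) : ℕ :=
  Nat.card (Quotient (G.connSetoid μ))

/-- The first Betti number `h1 = |E| − |V| + h0` of the subgraph with edge set `μ`.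
(Isolated vertices contribute equally to `|V|` and to `h0`, so this agrees with
the first Betti number of the subgraph whose vertices are the endpoints of the
edges in `μ`.) -/
noncomputable def h1 (μ : Set G.E) : ℤ :=
  (Nat.card μ : ℤ) - (Nat.card G.V : ℤ) + (G.h0 μ : ℤ)

/-- A subgraph (identified with its edge set) is core (1PI): removing any one of
its edges lowers `h1`. -/
def IsCore (μ : Set G.E) : Prop :=
  ∀ e ∈ μ, G.h1 (μ \ {e}) < G.h1 μ

/-- The multigraph is connected. -/
def Connected : Prop := G.h0 Set.univ = 1

/-- The contraction `Γ//γ`: each connected component of `γ` is contracted to a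
single vertex and the edges of `γ` are deleted. -/
def contract (γ : Set G.E) : Multigraph where
  V := Quotient (G.connSetoid γ)
  E := {e : G.E // e ∉ γ}
  finV := Quotient.finite _
  finE := Subtype.finite
  ends e := (G.ends e.1).map (Quotient.mk (G.connSetoid γ))

/-- The subgraph with edge set `γ`, as a multigraph in its own right. -/
def restrict (γ : Set G.E) : Multigraph where
  V := G.V
  E := γ
  finV := G.finV
  finE := Subtype.finite
  ends e := G.ends e.1

/-- `F` is a spanning forest: it is acyclic and consists of one spanning tree of
each connected component (equivalently, it induces the same connectivity
relation as the full edge set). -/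
def IsSpanningForest (F : Set G.E) : Prop :=
  G.h1 F = 0 ∧ G.connSetoid F = G.connSetoid Set.univ

/-- The first Kirchhoff–Symanzik (graph) polynomial
`ψ(Γ) = Σ_F Π_{e ∉ F} A_e`, the sum over spanning forests. -/
noncomputable def kirchhoff : MvPolynomial G.E ℤ :=
  ∑ᶠ F ∈ {F : Set G.E | G.IsSpanningForest F}, ∏ᶠ e ∈ Fᶜ, MvPolynomial.X e

/-- Euclidean dot product on `ℝ^D`. -/
noncomputable def dot {D : ℕ} (x y : Fin D → ℝ) : ℝ := ∑ i, x i * y i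

/-- The total momentum entering the connected component `c` of `(V(G), F)`. -/
noncomputable def momentumOf {D : ℕ} (q : G.V → Fin D → ℝ) (F : Set G.E)
    (c : Quotient (G.connSetoid F)) : Fin D → ℝ :=
  ∑ᶠ v ∈ {v : G.V | Quotient.mk (G.connSetoid F) v = c}, q v

/-- The second Kirchhoff–Symanzik polynomial
`φ(Γ) = Σ_{(T₁,T₂)} (Q(T₁)·Q(T₂)) Π_{e ∉ T₁∪T₂} A_e`, the sum over spanning
2-forests, i.e. acyclic edge sets `F` with exactly two connected components
`T₁, T₂` (jointly covering all vertices); `Q(T_i)` is the sum of the momenta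
over the vertices of `T_i`, and `Q(T₁)·Q(T₂)` is computed symmetrically via
`Q(T₁)·Q(T₂) = ((Q(T₁)+Q(T₂))² − Q(T₁)² − Q(T₂)²)/2`. -/
noncomputable def symanzik2 (D : ℕ) (q : G.V → Fin D → ℝ) : MvPolynomial G.E ℝ :=
  ∑ᶠ F ∈ {F : Set G.E | G.h1 F = 0 ∧ G.h0 F = 2},
    MvPolynomial.C
      ((dot (∑ᶠ v, q v) (∑ᶠ v, q v) -
          ∑ᶠ c : Quotient (G.connSetoid F), dot (G.momentumOf q F c) (G.momentumOf q F c)) / 2) *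
      ∏ᶠ e ∈ Fᶜ, MvPolynomial.X e

/-- External momenta pass to the contraction `Γ//γ` by assigning to each vertex
(i.e. each connected component of `γ`, or untouched vertex) the sum of the
momenta of the vertices identified to it. -/
noncomputable def contractMomenta (γ : Set G.E) {D : ℕ} (q : G.V → Fin D → ℝ) :
    (G.contract γ).V → Fin D → ℝ :=
  fun c => ∑ᶠ v ∈ {v : G.V | Quotient.mk (G.connSetoid γ) v = c}, q v

/-- A flag of core subgraphs of the subgraph `γ`: a chain (under inclusion) of
nonempty core subgraphs of `γ`, having `γ` itself as its largest member.  We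
encode a flag as its set of members. -/
def IsCoreFlagIn (γ : Set G.E) (F : Set (Set G.E)) : Prop :=
  γ ∈ F ∧ ∅ ∉ F ∧ (∀ δ ∈ F, δ ⊆ γ ∧ G.IsCore δ) ∧ IsChain (· ⊆ ·) F

/-- A maximal flag of core subgraphs of `γ`: one admitting no refinement. -/
def IsMaximalCoreFlagIn (γ : Set G.E) (F : Set (Set G.E)) : Prop :=
  G.IsCoreFlagIn γ F ∧ ∀ F' : Set (Set G.E), G.IsCoreFlagIn γ F' → F ⊆ F' → F' = F

/-- A flag of core subgraphs of `Γ`. -/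
def IsCoreFlag (F : Set (Set G.E)) : Prop := G.IsCoreFlagIn Set.univ F

/-- A maximal flag of core subgraphs of `Γ`. -/
def IsMaximalCoreFlag (F : Set (Set G.E)) : Prop := G.IsMaximalCoreFlagIn Set.univ F

end Multigraph

theorem finsum_mem_fiberwise {α β M : Type*} [Finite α] [Finite β] [AddCommMonoid M]
    (f : α → β) (q : α → M) (s : Set β) :
    ∑ᶠ c ∈ s, ∑ᶠ v ∈ {v | f v = c}, q v = ∑ᶠ v ∈ f ⁻¹' s, q v := by
  rw [← finsum_mem_biUnion _ s.toFinite fun _ _ => Set.toFinite _]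
  · congr! 3 with v
    simp
  · intro c _ c' _ hcc
    refine Set.disjoint_left.2 fun v hv hv' => hcc ?_
    exact Eq.trans (Eq.symm hv) hv'

theorem finsum_mem_mul_finsum_mem {α β R : Type*} [Finite α] [Finite β] [Semiring R]
    (f : α → R) (g : β → R) (s : Set α) (t : Set β) :
    (∑ᶠ a ∈ s, f a) * ∑ᶠ b ∈ t, g b = ∑ᶠ p ∈ s ×ˢ t, f p.1 * g p.2 := by
  have h : (s ×ˢ t).toFinite.toFinset = s.toFinite.toFinset ×ˢ t.toFinite.toFinset := by
    ext
    simp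
  rw [finsum_mem_eq_finite_toFinset_sum _ s.toFinite,
    finsum_mem_eq_finite_toFinset_sum _ t.toFinite,
    finsum_mem_eq_finite_toFinset_sum _ (s ×ˢ t).toFinite, h, Finset.sum_mul_sum,
    Finset.sum_product]

namespace MvPolynomial

theorem finprod_mem_X {σ R : Type*} [Finite σ] [CommSemiring R] (s : Set σ) :
    ∏ᶠ e ∈ s, (X e : MvPolynomial σ R) =
      monomial (Finsupp.equivFunOnFinite.symm (s.indicator 1)) 1 := by
  have := Fintype.ofFinite σ
  rw [finprod_mem_def, finprod_eq_prod_of_fintype, monomial_eq, C_1, one_mul,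
    Finsupp.prod_fintype _ _ (by simp)]
  refine Finset.prod_congr rfl fun e _ => ?_
  by_cases he : e ∈ s <;> simp [he]

theorem finsum_mem_of_mem_support_C_mul_finprod_X {σ R : Type*} [Finite σ] [CommSemiring R]
    {c : R} {s : Set σ} {d : σ →₀ ℕ} (hd : d ∈ (C c * ∏ᶠ e ∈ s, X e).support) (t : Set σ) :
    ∑ᶠ e ∈ t, d e = (t ∩ s).ncard := by
  rw [finprod_mem_X, C_mul_monomial] at hd
  obtain rfl := Finset.mem_singleton.1 (support_monomial_subset hd)
  rw [← finsum_one, finsum_mem_def, finsum_mem_def, ← Set.indicator_indicator]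
  rfl

theorem map_finprod_mem_X {σ R S : Type*} [Finite σ] [CommSemiring R] [CommSemiring S]
    (f : R →+* S) (s : Set σ) :
    map f (∏ᶠ e ∈ s, (X e : MvPolynomial σ R)) = ∏ᶠ e ∈ s, X e := by
  simp [finprod_mem_X, map_monomial]

theorem rename_finprod_mem_X {σ τ R : Type*} [Finite σ] [CommSemiring R] {f : σ → τ}
    (hf : Function.Injective f) (s : Set σ) :
    rename f (∏ᶠ e ∈ s, (X e : MvPolynomial σ R)) = ∏ᶠ e ∈ f '' s, X e := by
  rw [finprod_mem_image hf.injOn]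
  refine ((rename (R := R) f).toRingHom.toMonoidHom.map_finprod_mem _ s.toFinite).trans ?_
  simp

end MvPolynomial

namespace Multigraph

variable (G : Multigraph)

theorem connSetoid_le_iff {μ : Set G.E} {r : Setoid G.V} :
    G.connSetoid μ ≤ r ↔ ∀ e ∈ μ, ∀ v w, G.ends e = s(v, w) → r v w := by
  constructor
  · intro h e he v w hvw
    exact h (Relation.EqvGen.rel _ _ ⟨e, he, hvw⟩)
  · intro h
    exact Setoid.eqvGen_le fun v w ⟨e, he, hvw⟩ => h e he v w hvw

theorem connSetoid_rel {μ : Set G.E} {e : G.E} (he : e ∈ μ) {v w : G.V}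
    (hvw : G.ends e = s(v, w)) : G.connSetoid μ v w :=
  Relation.EqvGen.rel _ _ ⟨e, he, hvw⟩

theorem connSetoid_mono {μ ν : Set G.E} (h : μ ⊆ ν) : G.connSetoid μ ≤ G.connSetoid ν :=
  G.connSetoid_le_iff.2 fun _ he _ _ hvw => G.connSetoid_rel (h he) hvw

theorem connSetoid_union (μ ν : Set G.E) :
    G.connSetoid (μ ∪ ν) = G.connSetoid μ ⊔ G.connSetoid ν := by
  apply le_antisymm
  · rw [connSetoid_le_iff]
    rintro e (he | he) v w hvw
    · exact (le_sup_left : G.connSetoid μ ≤ _) (G.connSetoid_rel he hvw)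
    · exact (le_sup_right : G.connSetoid ν ≤ _) (G.connSetoid_rel he hvw)
  · exact sup_le (G.connSetoid_mono Set.subset_union_left)
      (G.connSetoid_mono Set.subset_union_right)

theorem h0_anti {μ ν : Set G.E} (h : μ ⊆ ν) : G.h0 ν ≤ G.h0 μ :=
  Nat.card_le_card_of_surjective (Quotient.map id fun _ _ hvw => G.connSetoid_mono h hvw)
    fun c => c.inductionOn fun v => ⟨Quotient.mk _ v, rfl⟩

theorem connSetoid_eq_of_h0_eq {μ ν : Set G.E} (h : μ ⊆ ν) (h0 : G.h0 μ = G.h0 ν) :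
    G.connSetoid μ = G.connSetoid ν := by
  let f : Quotient (G.connSetoid μ) → Quotient (G.connSetoid ν) :=
    Quotient.map id fun _ _ hvw => G.connSetoid_mono h hvw
  have hf : Function.Surjective f :=
    fun c => c.inductionOn fun v => ⟨Quotient.mk _ v, rfl⟩
  have hb : Function.Bijective f :=
    (Nat.bijective_iff_surjective_and_card f).2 ⟨hf, h0⟩
  refine le_antisymm (G.connSetoid_mono h) fun v w hvw => ?_
  have : f (Quotient.mk _ v) = f (Quotient.mk _ w) := Quotient.sound hvw
  exact Quotient.exact (hb.1 this)

theorem h0_le_h0_insert (e : G.E) (μ : Set G.E) : G.h0 μ ≤ G.h0 (insert e μ) + 1 := by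
  obtain ⟨⟨a, b⟩, hab⟩ := Quot.exists_rep (G.ends e)
  let mk : G.V → Quotient (G.connSetoid μ) := Quotient.mk _
  let φ : G.V → Quotient (G.connSetoid μ) := fun v => if mk v = mk a then mk b else mk v
  have hle : G.connSetoid (insert e μ) ≤ Setoid.ker φ := by
    rw [connSetoid_le_iff]
    rintro e' (rfl | he') v w hvw
    · have hφ : φ a = φ b := by simp [φ]
      rw [← hab] at hvw
      rcases Sym2.eq_iff.1 hvw with ⟨rfl, rfl⟩ | ⟨rfl, rfl⟩
      · exact hφ
      · exact hφ.symm
    · have : mk v = mk w := Quotient.sound (G.connSetoid_rel he' hvw)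
      change φ v = φ w
      simp [φ, this]
  let g : Quotient (G.connSetoid μ) → Option (Quotient (G.connSetoid (insert e μ))) := fun c =>
    if c = mk a then none
    else some (Quotient.map id (fun _ _ h => G.connSetoid_mono (Set.subset_insert e μ) h) c)
  have hg : Function.Injective g := by
    intro c c'
    induction c using Quotient.inductionOn with | _ v
    induction c' using Quotient.inductionOn with | _ w
    change g (mk v) = g (mk w) → mk v = mk w
    intro h
    by_cases hv : mk v = mk a <;> by_cases hw : mk w = mk a
    · rw [hv, hw]
    · simp [g, hv, hw] at h
    · simp [g, hv, hw] at h
    · simp only [g, hv, hw, if_false, Option.some.injEq] at h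
      have := hle (Quotient.exact h)
      change φ v = φ w at this
      simpa [φ, hv, hw] using this
  have := Nat.card_le_card_of_injective g hg
  rwa [Finite.card_option] at this

theorem h1_le_h1_insert (e : G.E) (μ : Set G.E) : G.h1 μ ≤ G.h1 (insert e μ) := by
  by_cases he : e ∈ μ
  · rw [Set.insert_eq_of_mem he]
  · have h := G.h0_le_h0_insert e μ
    have hc : Nat.card ↑(insert e μ) = Nat.card μ + 1 := Set.ncard_insert_of_notMem he
    unfold h1
    omega

theorem h1_mono {μ ν : Set G.E} (h : μ ⊆ ν) : G.h1 μ ≤ G.h1 ν := by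
  have key : ∀ t : Set G.E, G.h1 μ ≤ G.h1 (t ∪ μ) := fun t => by
    induction t, t.toFinite using Set.Finite.induction_on with
    | empty => simp
    | insert _ _ ih =>
      rw [Set.insert_union]
      exact ih.trans (G.h1_le_h1_insert _ _)
  simpa [Set.union_eq_self_of_subset_right h] using key ν

theorem h1_empty : G.h1 ∅ = 0 := by
  have : G.connSetoid ∅ = ⊥ := le_bot_iff.1 (G.connSetoid_le_iff.2 (by simp))
  have hc : G.h0 ∅ = Nat.card G.V := by
    unfold h0
    rw [this]
    refine (Nat.card_congr (Equiv.ofBijective (Quotient.mk (⊥ : Setoid G.V))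
      ⟨fun v w h => ?_, Quotient.mk_surjective⟩)).symm
    exact Quotient.exact h
  simp [h1, hc]

theorem h1_nonneg (μ : Set G.E) : 0 ≤ G.h1 μ :=
  G.h1_empty ▸ G.h1_mono (Set.empty_subset μ)

theorem restrict_connSetoid (γ F : Set G.E) :
    (G.restrict γ).connSetoid ((Subtype.val : γ → G.E) ⁻¹' F) = G.connSetoid (F ∩ γ) := by
  apply le_antisymm
  · exact (connSetoid_le_iff _).2 fun e he v w hvw =>
      G.connSetoid_rel (μ := F ∩ γ) (e := e.1) ⟨he, e.2⟩ hvw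
  · exact (connSetoid_le_iff _).2 fun e he v w hvw =>
      (G.restrict γ).connSetoid_rel (e := ⟨e, he.2⟩) he.1 hvw

theorem restrict_h1 (γ F : Set G.E) :
    (G.restrict γ).h1 ((Subtype.val : γ → G.E) ⁻¹' F) = G.h1 (F ∩ γ) := by
  have hc : Nat.card ((Subtype.val : γ → G.E) ⁻¹' F) = Nat.card ↑(F ∩ γ) := by
    change Set.ncard _ = Set.ncard _
    rw [← Set.ncard_image_of_injective _ Subtype.val_injective, Subtype.image_preimage_coe,
      Set.inter_comm]
  have h0 : (G.restrict γ).h0 ((Subtype.val : γ → G.E) ⁻¹' F) = G.h0 (F ∩ γ) := by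
    unfold h0
    rw [G.restrict_connSetoid γ F]
    rfl
  unfold h1
  rw [h0]
  exact congrArg (fun n : ℕ => (n : ℤ) - _ + _) hc

theorem restrict_isSpanningForest_iff (γ F : Set G.E) :
    (G.restrict γ).IsSpanningForest ((Subtype.val : γ → G.E) ⁻¹' F) ↔
      G.h1 (F ∩ γ) = 0 ∧ G.connSetoid (F ∩ γ) = G.connSetoid γ := by
  have hu : (G.restrict γ).connSetoid Set.univ = G.connSetoid γ := by
    have h := G.restrict_connSetoid γ Set.univ
    rwa [Set.univ_inter] at h
  rw [← restrict_h1, ← restrict_connSetoid, ← hu]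
  rfl

/-- The edges of `F` surviving in the contraction `Γ//γ`. -/
def contractEdges (γ F : Set G.E) : Set (G.contract γ).E :=
  (Subtype.val : {e : G.E // e ∉ γ} → G.E) ⁻¹' F

theorem contract_connSetoid_iff (γ F : Set G.E) (v w : G.V) :
    G.connSetoid (F ∪ γ) v w ↔ (G.contract γ).connSetoid (G.contractEdges γ F)
      (Quotient.mk (G.connSetoid γ) v) (Quotient.mk (G.connSetoid γ) w) := by
  constructor
  · have h : G.connSetoid (F ∪ γ) ≤ ((G.contract γ).connSetoid (G.contractEdges γ F)).comap
        (Quotient.mk (G.connSetoid γ)) := by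
      rw [connSetoid_le_iff]
      intro e he v w hvw
      change ((G.contract γ).connSetoid (G.contractEdges γ F)) (Quotient.mk _ v) (Quotient.mk _ w)
      by_cases heγ : e ∈ γ
      · rw [show Quotient.mk (G.connSetoid γ) v = Quotient.mk _ w from
          Quotient.sound (G.connSetoid_rel heγ hvw)]
        exact Setoid.refl' _ _
      · refine (G.contract γ).connSetoid_rel (e := ⟨e, heγ⟩) (he.resolve_right heγ) ?_
        change (G.ends e).map _ = _
        rw [hvw]
        rfl
    exact fun hvw => h hvw
  · have hγ := G.connSetoid_mono (Set.subset_union_right : γ ⊆ F ∪ γ)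
    let f : (G.contract γ).V → Quotient (G.connSetoid (F ∪ γ)) :=
      Quotient.map id fun _ _ h => hγ h
    have h : (G.contract γ).connSetoid (G.contractEdges γ F) ≤ Setoid.ker f := by
      rw [connSetoid_le_iff]
      rintro ⟨e, he⟩ heF c c' hcc
      change (G.ends e).map (Quotient.mk (G.connSetoid γ)) = _ at hcc
      obtain ⟨⟨a, b⟩, hab⟩ := Quot.exists_rep (G.ends e)
      have hab' : G.ends e = s(a, b) := hab.symm
      have hf : f (Quotient.mk _ a) = f (Quotient.mk _ b) :=
        Quotient.sound (G.connSetoid_rel (Or.inl heF) hab')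
      rw [hab', Sym2.map_mk] at hcc
      rcases Sym2.eq_iff.1 hcc with ⟨rfl, rfl⟩ | ⟨rfl, rfl⟩
      · exact hf
      · exact hf.symm
    exact fun hvw => Quotient.exact (h hvw)

/-- Components of `F ∪ γ` are the components of the image of `F` in `Γ//γ`. -/
noncomputable def contractComponents (γ F : Set G.E) :
    Quotient (G.connSetoid (F ∪ γ)) ≃
      Quotient ((G.contract γ).connSetoid (G.contractEdges γ F)) :=
  Equiv.ofBijective
    (Quotient.lift (fun v => Quotient.mk _ (Quotient.mk (G.connSetoid γ) v))
      fun v w h => Quotient.sound ((G.contract_connSetoid_iff γ F v w).1 h))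
    ⟨by
      intro c c'
      induction c using Quotient.inductionOn with | _ v
      induction c' using Quotient.inductionOn with | _ w
      exact fun h => Quotient.sound ((G.contract_connSetoid_iff γ F v w).2 (Quotient.exact h)),
    fun c => c.inductionOn fun d => Quotient.inductionOn d fun v => ⟨Quotient.mk _ v, rfl⟩⟩

theorem contract_h0 (γ F : Set G.E) :
    (G.contract γ).h0 (G.contractEdges γ F) = G.h0 (F ∪ γ) :=
  (Nat.card_congr (G.contractComponents γ F)).symm

theorem connSetoid_eq_union {γ F : Set G.E} (h : G.connSetoid (F ∩ γ) = G.connSetoid γ) :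
    G.connSetoid F = G.connSetoid (F ∪ γ) := by
  rw [connSetoid_union, ← h, ← connSetoid_union, Set.union_eq_self_of_subset_right
    Set.inter_subset_left]

theorem h0_eq_union {γ F : Set G.E} (h : G.connSetoid (F ∩ γ) = G.connSetoid γ) :
    G.h0 F = G.h0 (F ∪ γ) := by
  unfold h0
  rw [G.connSetoid_eq_union h]

theorem h1_eq_add {γ F : Set G.E} (h : G.connSetoid (F ∩ γ) = G.connSetoid γ) :
    G.h1 F = G.h1 (F ∩ γ) + (G.contract γ).h1 (G.contractEdges γ F) := by
  have h0 : G.h0 (F ∩ γ) = Nat.card (G.contract γ).V := by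
    unfold h0
    rw [h]
    rfl
  have hc : Nat.card (G.contractEdges γ F) = Nat.card ↑(F \ γ) := by
    change Set.ncard _ = Set.ncard _
    refine (Set.ncard_image_of_injective _ Subtype.val_injective).symm.trans (congrArg _ ?_)
    change Subtype.val '' ((Subtype.val : {e : G.E // e ∉ γ} → G.E) ⁻¹' F) = _
    ext e
    simp [and_comm]
  have hs : Nat.card ↑(F ∩ γ) + Nat.card ↑(F \ γ) = Nat.card F :=
    Set.ncard_inter_add_ncard_sdiff_eq_ncard F γ
  have hF := G.h0_eq_union h
  unfold h1
  rw [contract_h0, ← hF, h0, hc]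
  omega

theorem h1_lt_ncard_diff {γ F : Set G.E} (hF : G.h1 F = 0)
    (h : G.connSetoid (F ∩ γ) ≠ G.connSetoid γ) : G.h1 γ < ((γ ∩ Fᶜ).ncard : ℤ) := by
  have h1 : G.h1 (F ∩ γ) = 0 :=
    le_antisymm (hF ▸ G.h1_mono Set.inter_subset_left) (G.h1_nonneg _)
  have hlt : G.h0 γ < G.h0 (F ∩ γ) := lt_of_le_of_ne (G.h0_anti Set.inter_subset_right)
    fun h' => h (G.connSetoid_eq_of_h0_eq Set.inter_subset_right h'.symm)
  have hs : Nat.card ↑(F ∩ γ) + (γ ∩ Fᶜ).ncard = Nat.card γ := by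
    rw [Set.inter_comm]
    exact Set.ncard_inter_add_ncard_sdiff_eq_ncard γ F
  unfold Multigraph.h1 at h1 ⊢
  omega

theorem contract_sum_momenta (γ : Set G.E) {D : ℕ} (q : G.V → Fin D → ℝ) :
    ∑ᶠ c, G.contractMomenta γ q c = ∑ᶠ v, q v := by
  have h := finsum_mem_fiberwise (Quotient.mk (G.connSetoid γ)) q Set.univ
  rw [Set.preimage_univ, finsum_mem_univ, finsum_mem_univ] at h
  exact h

theorem contract_momentumOf (γ F : Set G.E) {D : ℕ} (q : G.V → Fin D → ℝ)
    (c : Quotient (G.connSetoid (F ∪ γ))) :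
    (G.contract γ).momentumOf (G.contractMomenta γ q) (G.contractEdges γ F)
      (G.contractComponents γ F c) = G.momentumOf q (F ∪ γ) c := by
  refine (finsum_mem_fiberwise (Quotient.mk (G.connSetoid γ)) q _).trans ?_
  refine congrArg (fun s : Set G.V => ∑ᶠ v ∈ s, q v) (Set.ext fun v => ?_)
  exact (G.contractComponents γ F).apply_eq_iff_eq (x := Quotient.mk _ v)

/-- The coefficient of the term of `φ(Γ)` indexed by `F`. -/
noncomputable def symanzik2Coeff {D : ℕ} (q : G.V → Fin D → ℝ) (F : Set G.E) : ℝ :=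
  (dot (∑ᶠ v, q v) (∑ᶠ v, q v) -
    ∑ᶠ c : Quotient (G.connSetoid F), dot (G.momentumOf q F c) (G.momentumOf q F c)) / 2

theorem symanzik2Coeff_congr {D : ℕ} (q : G.V → Fin D → ℝ) {F F' : Set G.E}
    (h : G.connSetoid F = G.connSetoid F') : G.symanzik2Coeff q F = G.symanzik2Coeff q F' := by
  unfold symanzik2Coeff momentumOf
  rw [h]

theorem contract_symanzik2Coeff {γ F : Set G.E} {D : ℕ} (q : G.V → Fin D → ℝ)
    (h : G.connSetoid (F ∩ γ) = G.connSetoid γ) :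
    (G.contract γ).symanzik2Coeff (G.contractMomenta γ q) (G.contractEdges γ F) =
      G.symanzik2Coeff q F := by
  rw [G.symanzik2Coeff_congr q (G.connSetoid_eq_union h)]
  unfold symanzik2Coeff
  rw [contract_sum_momenta, ← finsum_comp_equiv (G.contractComponents γ F)]
  simp only [contract_momentumOf]

theorem symanzik2_eq {D : ℕ} (q : G.V → Fin D → ℝ) :
    G.symanzik2 D q = ∑ᶠ F ∈ {F : Set G.E | G.h1 F = 0 ∧ G.h0 F = 2},
      MvPolynomial.C (G.symanzik2Coeff q F) * ∏ᶠ e ∈ Fᶜ, MvPolynomial.X e :=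
  rfl

theorem rename_symanzik2 {τ : Type} {f : G.E → τ} (hf : Function.Injective f) {D : ℕ}
    (q : G.V → Fin D → ℝ) :
    MvPolynomial.rename f (G.symanzik2 D q) =
      ∑ᶠ F ∈ {F : Set G.E | G.h1 F = 0 ∧ G.h0 F = 2},
        MvPolynomial.C (G.symanzik2Coeff q F) * ∏ᶠ e ∈ f '' Fᶜ, MvPolynomial.X e := by
  rw [symanzik2_eq]
  refine ((MvPolynomial.rename (R := ℝ) f).toRingHom.toAddMonoidHom.map_finsum_mem _
    (Set.toFinite _)).trans ?_
  refine finsum_mem_congr rfl fun F _ => ?_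
  rw [← MvPolynomial.rename_finprod_mem_X hf]
  change MvPolynomial.rename f (_ * _) = _
  rw [map_mul, MvPolynomial.rename_C]

theorem rename_map_kirchhoff {τ R : Type} [CommRing R] [Finite τ] {f : G.E → τ}
    (hf : Function.Injective f) :
    MvPolynomial.rename f (MvPolynomial.map (Int.castRingHom R) G.kirchhoff) =
      ∑ᶠ F ∈ {F : Set G.E | G.IsSpanningForest F}, ∏ᶠ e ∈ f '' Fᶜ, MvPolynomial.X e := by
  rw [← MvPolynomial.map_rename]
  unfold kirchhoff
  refine (((MvPolynomial.map (Int.castRingHom R)).comp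
    (MvPolynomial.rename (R := ℤ) f).toRingHom).toAddMonoidHom.map_finsum_mem _
      (Set.toFinite _)).trans ?_
  refine finsum_mem_congr rfl fun F _ => ?_
  change MvPolynomial.map _ (MvPolynomial.rename f _) = _
  rw [MvPolynomial.rename_finprod_mem_X hf, MvPolynomial.map_finprod_mem_X]

theorem mem_forests_iff (γ F : Set G.E) :
    ((G.contract γ).h1 (G.contractEdges γ F) = 0 ∧
        (G.contract γ).h0 (G.contractEdges γ F) = 2) ∧
      (G.restrict γ).IsSpanningForest ((Subtype.val : γ → G.E) ⁻¹' F) ↔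
    (G.h1 F = 0 ∧ G.h0 F = 2) ∧ G.connSetoid (F ∩ γ) = G.connSetoid γ := by
  rw [restrict_isSpanningForest_iff, ← and_assoc]
  refine and_congr_left fun h => ?_
  rw [contract_h0, ← G.h0_eq_union h, G.h1_eq_add h]
  have h₁ := G.h1_nonneg (F ∩ γ)
  have h₂ := (G.contract γ).h1_nonneg (G.contractEdges γ F)
  omega

theorem bijective_contract_restrict (γ : Set G.E) :
    Function.Bijective fun F : Set G.E =>
      (G.contractEdges γ F, ((Subtype.val : γ → G.E) ⁻¹' F : Set (G.restrict γ).E)) := by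
  constructor
  · intro F F' h
    obtain ⟨h₁, h₂⟩ := Prod.mk.inj h
    ext e
    by_cases he : e ∈ γ
    · exact Set.ext_iff.1 h₂ ⟨e, he⟩
    · exact Set.ext_iff.1 h₁ ⟨e, he⟩
  · rintro ⟨F₂, F₁⟩
    refine ⟨{e | if h : e ∈ γ then (⟨e, h⟩ : γ) ∈ F₁ else
      (⟨e, h⟩ : {e : G.E // e ∉ γ}) ∈ F₂}, Prod.ext ?_ ?_⟩
    · refine Set.ext fun e => ?_
      change (if h : e.1 ∈ γ then (⟨e.1, h⟩ : γ) ∈ F₁ else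
        (⟨e.1, h⟩ : {e : G.E // e ∉ γ}) ∈ F₂) ↔ _
      rw [dif_neg e.2]
      rfl
    · refine Set.ext fun e => ?_
      change (if h : e.1 ∈ γ then (⟨e.1, h⟩ : γ) ∈ F₁ else
        (⟨e.1, h⟩ : {e : G.E // e ∉ γ}) ∈ F₂) ↔ _
      rw [dif_pos e.2]
      rfl

theorem contract_symanzik2_mul_restrict_kirchhoff (γ : Set G.E) {D : ℕ} (q : G.V → Fin D → ℝ) :
    MvPolynomial.rename (fun e : (G.contract γ).E => (e.1 : G.E))
        ((G.contract γ).symanzik2 D (G.contractMomenta γ q)) *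
      MvPolynomial.rename (fun e : (G.restrict γ).E => (e.1 : G.E))
        (MvPolynomial.map (Int.castRingHom ℝ) (G.restrict γ).kirchhoff) =
    ∑ᶠ F ∈ {F : Set G.E | G.h1 F = 0 ∧ G.h0 F = 2} ∩
        {F | G.connSetoid (F ∩ γ) = G.connSetoid γ},
      MvPolynomial.C (G.symanzik2Coeff q F) * ∏ᶠ e ∈ Fᶜ, MvPolynomial.X e := by
  have hbij : Set.BijOn
      (fun F => (G.contractEdges γ F, ((Subtype.val : γ → G.E) ⁻¹' F : Set (G.restrict γ).E)))
      ({F : Set G.E | G.h1 F = 0 ∧ G.h0 F = 2} ∩ {F | G.connSetoid (F ∩ γ) = G.connSetoid γ})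
      ({F | (G.contract γ).h1 F = 0 ∧ (G.contract γ).h0 F = 2} ×ˢ
        {F | (G.restrict γ).IsSpanningForest F}) := by
    refine ⟨fun F hF => (G.mem_forests_iff γ F).2 hF,
      (G.bijective_contract_restrict γ).1.injOn, fun p hp => ?_⟩
    obtain ⟨F, rfl⟩ := (G.bijective_contract_restrict γ).2 p
    exact ⟨F, (G.mem_forests_iff γ F).1 hp, rfl⟩
  rw [rename_symanzik2 _ Subtype.val_injective, rename_map_kirchhoff _ Subtype.val_injective,
    finsum_mem_mul_finsum_mem]
  refine (finsum_mem_eq_of_bijOn _ hbij fun F hF => ?_).symm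
  have h₁ : (fun e : (G.contract γ).E => (e.1 : G.E)) '' (G.contractEdges γ F)ᶜ = Fᶜ \ γ := by
    change Subtype.val '' ((Subtype.val : {e : G.E // e ∉ γ} → G.E) ⁻¹' Fᶜ) = _
    ext e
    simp [and_comm]
  have h₂ : (fun e : (G.restrict γ).E => (e.1 : G.E)) ''
      ((Subtype.val : γ → G.E) ⁻¹' F)ᶜ = Fᶜ ∩ γ := by
    change Subtype.val '' ((Subtype.val : γ → G.E) ⁻¹' Fᶜ) = _
    rw [Subtype.image_preimage_coe, Set.inter_comm]
  dsimp only
  rw [G.contract_symanzik2Coeff q hF.2, mul_assoc, h₁, h₂, mul_comm (finprod _),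
    finprod_mem_inter_mul_sdiff _ (Set.toFinite _)]

end Multigraph

/-- `φ(Γ) = φ(Γ//γ)·ψ(γ) + φ_{Γ,γ}`, where every monomial of the
remainder `φ_{Γ,γ} = φ(Γ) − φ(Γ//γ)·ψ(γ)` has degree in the variables of `γ`
strictly greater than `h1(γ)`. -/
theorem symanzik2_contract_factorization (G : Multigraph) (hG : G.Connected)
    (hcore : G.IsCore Set.univ) (γ : Set G.E) (hγ : G.IsCore γ)
    (D : ℕ) (q : G.V → Fin D → ℝ) (hq : ∑ᶠ v, q v = 0) :
    ∀ d ∈ (G.symanzik2 D q -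
        MvPolynomial.rename (fun e : (G.contract γ).E => (e.1 : G.E))
            ((G.contract γ).symanzik2 D (G.contractMomenta γ q)) *
        MvPolynomial.rename (fun e : (G.restrict γ).E => (e.1 : G.E))
            (MvPolynomial.map (Int.castRingHom ℝ) (G.restrict γ).kirchhoff)).support,
      G.h1 γ < ((∑ᶠ e ∈ γ, d e : ℕ) : ℤ) := by
  intro d hd
  rw [G.contract_symanzik2_mul_restrict_kirchhoff γ q, Multigraph.symanzik2_eq,
    ← finsum_mem_inter_add_sdiff {F | G.connSetoid (F ∩ γ) = G.connSetoid γ} (Set.toFinite _),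
    add_sub_cancel_left, finsum_mem_eq_finite_toFinset_sum _ (Set.toFinite _)] at hd
  obtain ⟨F, hF, hdF⟩ := Finset.mem_biUnion.1 (MvPolynomial.support_sum hd)
  rw [Set.Finite.mem_toFinset] at hF
  rw [MvPolynomial.finsum_mem_of_mem_support_C_mul_finprod_X hdF]
  exact G.h1_lt_ncard_diff hF.1.1 hF.2
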